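/- Let k be a field of characteristic zero, S a commutative wheelgebra, and { , }_{n,m} : S(n) × S(m) → S(n+m) a k-bilinear family that is equivariant ({σ·v·τ, σ′·w·τ′}_{n,m} = s_{n,m}(σ,σ′)·{v,w}_{n,m}·s_{n,m}(τ,τ′)), skew-symmetric ({v,w}_{n,m} = − b_{m,n}(1 2)·{w,v}_{m,n}·b_{n,m}(1 2)), and satisfies the Leibniz identity {u, μ_{n,m}(v,w)}_{p,n+m} = μ_{p+n,m}({u,v}_{p,n}, w) + b_{n,p,m}(1 2)·μ_{n,p+m}(v, {u,w}_{p,m})·b_{p,n,m}(1 2) for all u ∈ S(p), v ∈ S(n), w ∈ S(m). Call an element v ∈ S(n) wheel-compatible if t^{n+p}_{n+j, n+i}({v, u}_{n,p}) = {v, t^p_{j,i}(u)}_{n,p−1} for all p ≥ 1, i, j ∈ {1,…,p} and u ∈ S(p). If v ∈ S(n) and w ∈ S(m) are wheel-compatible, then μ_{n,m}(v,w) ∈ S(n+m) is wheel-compatible. -/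

import Mathlib

/-- The cycle `(a … b)` inside the group of permutations of `ℕ` (1-indexed):
it sends `j` to `j + 1` for `a ≤ j < b`, sends `b` to `a`, and fixes every
other natural number. -/
def cyc (a b : ℕ) : Equiv.Perm ℕ :=
  ((List.range' a (b - a)).map fun j => Equiv.swap j (j + 1)).prod

/-- Membership in `S_n ⊆ Perm ℕ` (1-indexed): `σ` fixes `0` and all `j > n`. -/
def memS (n : ℕ) (σ : Equiv.Perm ℕ) : Prop :=
  ∀ j : ℕ, j = 0 ∨ n < j → σ j = j

/-- `r^n_i(σ)`, realized inside `Perm ℕ` via the conjugation formula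
`e_{n-1}(r^n_i(σ)) = (σ(i) … n)⁻¹ σ (i … n)` (for `σ ∈ S_n` this agrees with
the defining piecewise formula on `{1,…,n-1}` and fixes everything else). -/
def rP (n i : ℕ) (σ : Equiv.Perm ℕ) : Equiv.Perm ℕ :=
  (cyc (σ i) n)⁻¹ * σ * cyc i n

/-- `l^n_i(σ) := (r^n_i(σ⁻¹))⁻¹`. -/
def lP (n i : ℕ) (σ : Equiv.Perm ℕ) : Equiv.Perm ℕ :=
  (rP n i σ⁻¹)⁻¹

/-- The block transposition `b_{a,b}(1 2) ∈ S_{a+b}` (1-indexed): it sends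
`j ↦ j + b` for `1 ≤ j ≤ a`, `j ↦ j - a` for `a < j ≤ a + b`, and fixes
everything else. -/
def blockT (a b : ℕ) : Equiv.Perm ℕ := cyc 1 (a + b) ^ b

/-- The block-diagonal embedding `s_{n,m} : S_n × S_m → S_{n+m}`: `σ ∈ S_n`
acts on `{1,…,n}` as itself and `σ' ∈ S_m` acts, shifted by `n`, on
`{n+1,…,n+m}`. -/
def sEmb (n m : ℕ) (σ σ' : Equiv.Perm ℕ) : Equiv.Perm ℕ :=
  σ * (blockT m n * σ' * (blockT m n)⁻¹)
/-- A diagonal `𝕊`-bimodule structure on the family of `k`-vector spaces `S`: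
for each `n`, commuting `k`-linear left and right actions of `S_n` on `S n`,
the left action being `σ·v = L n σ v` and the right action `v·τ = R n τ v`
(only the values on permutations belonging to `S_n` are relevant). -/
def IsDiagAction (k : Type) [Field k] (S : ℕ → Type)
    [∀ n, AddCommGroup (S n)] [∀ n, Module k (S n)]
    (L R : ∀ n, Equiv.Perm ℕ → S n →ₗ[k] S n) : Prop :=
  ∀ n : ℕ,
    (∀ v : S n, L n 1 v = v ∧ R n 1 v = v) ∧
    (∀ σ τ : Equiv.Perm ℕ, memS n σ → memS n τ → ∀ v : S n,
      L n (σ * τ) v = L n σ (L n τ v) ∧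
      R n (σ * τ) v = R n τ (R n σ v) ∧
      L n σ (R n τ v) = R n τ (L n σ v))

/-- The family of contractions `t^{n+1}_{j,i} = t n j i : S (n+1) → S n`
(`1 ≤ i, j ≤ n+1`) makes the diagonal `𝕊`-bimodule `S` a wheelspace:
axiom (W.1): `t^n_{j,i}(σ·v·τ) = l^n_j(σ) · t^n_{σ⁻¹(j),τ(i)}(v) · r^n_i(τ)`,
and axiom (W.2): `t^n_{j,i} ∘ t^{n+1}_{ℓ,k} = t^n_{j',i'} ∘ t^{n+1}_{ℓ',k'}`
where `(i',k') = (k-1,i)` if `i < k`, `(i',k') = (k,i+1)` if `k ≤ i`, and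
`(j',ℓ')` is obtained from `(j,ℓ)` by the same rule. -/
def IsWheel (k : Type) [Field k] (S : ℕ → Type)
    [∀ n, AddCommGroup (S n)] [∀ n, Module k (S n)]
    (L R : ∀ n, Equiv.Perm ℕ → S n →ₗ[k] S n)
    (t : ∀ n : ℕ, ℕ → ℕ → (S (n + 1) →ₗ[k] S n)) : Prop :=
  (∀ n i j : ℕ, 1 ≤ i → i ≤ n + 1 → 1 ≤ j → j ≤ n + 1 →
    ∀ σ τ : Equiv.Perm ℕ, memS (n + 1) σ → memS (n + 1) τ → ∀ v : S (n + 1),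
      t n j i (L (n + 1) σ (R (n + 1) τ v)) =
        L n (lP (n + 1) j σ) (R n (rP (n + 1) i τ) (t n (σ⁻¹ j) (τ i) v))) ∧
  (∀ n i j a b : ℕ, 1 ≤ i → i ≤ n + 1 → 1 ≤ j → j ≤ n + 1 →
    1 ≤ a → a ≤ n + 2 → 1 ≤ b → b ≤ n + 2 → ∀ v : S (n + 2),
      t n j i (t (n + 1) b a v) =
        t n (if j < b then b - 1 else b) (if i < a then a - 1 else a)
          (t (n + 1) (if j < b then j else j + 1) (if i < a then i else i + 1) v))
/-- `(S, mu, eta)` is a (unitary, associative) wheelgebra: the wheelspace `S`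
carries `k`-bilinear products `μ_{n,m} = mu n m : S n × S m → S (n+m)` and a
unit `η = eta ∈ S 0` which are associative and unital, equivariant for the
block-diagonal embeddings `s_{n,m}`, and compatible with the contractions:
`t^{n+m}_{j,i}(μ_{n,m}(v,w)) = μ_{n-1,m}(t^n_{j,i}(v), w)` for
`i, j ∈ {1,…,n}` and
`t^{n+m}_{j,i}(μ_{n,m}(v,w)) = μ_{n,m-1}(v, t^m_{j-n,i-n}(w))` for
`i, j ∈ {n+1,…,n+m}`. -/
def IsWheelgebra (k : Type) [Field k] (S : ℕ → Type)
    [∀ n, AddCommGroup (S n)] [∀ n, Module k (S n)]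
    (L R : ∀ n, Equiv.Perm ℕ → S n →ₗ[k] S n)
    (t : ∀ n : ℕ, ℕ → ℕ → (S (n + 1) →ₗ[k] S n))
    (mu : ∀ n m : ℕ, S n →ₗ[k] S m →ₗ[k] S (n + m)) (eta : S 0) : Prop :=
  IsDiagAction k S L R ∧ IsWheel k S L R t ∧
  (∀ (n m p : ℕ) (u : S n) (v : S m) (w : S p),
      mu (n + m) p (mu n m u v) w =
        cast (congrArg S (by omega : n + (m + p) = n + m + p))
          (mu n (m + p) u (mu m p v w))) ∧
  (∀ (n : ℕ) (v : S n),
      cast (congrArg S (by omega : 0 + n = n)) (mu 0 n eta v) = v ∧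
      mu n 0 v eta = v) ∧
  (∀ (n m : ℕ) (σ τ σ' τ' : Equiv.Perm ℕ),
      memS n σ → memS n τ → memS m σ' → memS m τ' →
      ∀ (v : S n) (w : S m),
        mu n m (L n σ (R n τ v)) (L m σ' (R m τ' w)) =
          L (n + m) (sEmb n m σ σ') (R (n + m) (sEmb n m τ τ') (mu n m v w))) ∧
  (∀ n m i j : ℕ, 1 ≤ i → i ≤ n + 1 → 1 ≤ j → j ≤ n + 1 →
      ∀ (v : S (n + 1)) (w : S m),
        t (n + m) j i
            (cast (congrArg S (by omega : n + 1 + m = n + m + 1))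
              (mu (n + 1) m v w)) =
          mu n m (t n j i v) w) ∧
  (∀ n m i j : ℕ, n + 1 ≤ i → i ≤ n + m + 1 → n + 1 ≤ j → j ≤ n + m + 1 →
      ∀ (v : S n) (w : S (m + 1)),
        t (n + m) j i
            (cast (congrArg S (by omega : n + (m + 1) = n + m + 1))
              (mu n (m + 1) v w)) =
          mu n m v (t m (j - n) (i - n) w))
/-- The wheelgebra `(S, mu, eta)` is commutative:
`μ_{n,m}(v, w) = b_{m,n}(1 2) · μ_{m,n}(w, v) · b_{n,m}(1 2)`. -/
def IsCommWheelgebra (k : Type) [Field k] (S : ℕ → Type)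
    [∀ n, AddCommGroup (S n)] [∀ n, Module k (S n)]
    (L R : ∀ n, Equiv.Perm ℕ → S n →ₗ[k] S n)
    (t : ∀ n : ℕ, ℕ → ℕ → (S (n + 1) →ₗ[k] S n))
    (mu : ∀ n m : ℕ, S n →ₗ[k] S m →ₗ[k] S (n + m)) (eta : S 0) : Prop :=
  IsWheelgebra k S L R t mu eta ∧
  ∀ (n m : ℕ) (v : S n) (w : S m),
    mu n m v w =
      cast (congrArg S (by omega : m + n = n + m))
        (L (m + n) (blockT m n) (R (m + n) (blockT n m) (mu m n w v)))

/-- `v ∈ S n` is wheel-compatible with respect to the bracket family `br`: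
`t^{n+p}_{n+j,n+i}({v, u}_{n,p}) = {v, t^p_{j,i}(u)}_{n,p-1}` for all `p ≥ 1`,
`i, j ∈ {1,…,p}` and `u ∈ S p`. -/
def WheelCompatible (k : Type) [Field k] (S : ℕ → Type)
    [∀ n, AddCommGroup (S n)] [∀ n, Module k (S n)]
    (t : ∀ n : ℕ, ℕ → ℕ → (S (n + 1) →ₗ[k] S n))
    (br : ∀ n m : ℕ, S n →ₗ[k] S m →ₗ[k] S (n + m))
    (n : ℕ) (v : S n) : Prop :=
  ∀ p i j : ℕ, 1 ≤ i → i ≤ p + 1 → 1 ≤ j → j ≤ p + 1 → ∀ u : S (p + 1),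
    t (n + p) (n + j) (n + i)
        (cast (congrArg S (by omega : n + (p + 1) = n + p + 1))
          (br n (p + 1) v u)) =
      br n p v (t p j i u)

section Permutations

theorem cyc_eq_swap_mul {a b : ℕ} (h : a < b) :
    cyc a b = Equiv.swap a (a + 1) * cyc (a + 1) b := by
  obtain ⟨d, rfl⟩ : ∃ d, b = a + 1 + d := ⟨b - (a + 1), by omega⟩
  simp [cyc, show a + 1 + d - a = d + 1 by omega, List.range'_succ]

theorem cyc_self (a : ℕ) : cyc a a = 1 := by simp [cyc]

theorem cyc_apply {a b : ℕ} (h : a ≤ b) (x : ℕ) :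
    cyc a b x = if a ≤ x ∧ x < b then x + 1 else if x = b then a else x := by
  induction h using Nat.decreasingInduction with
  | self => rw [cyc_self]; simp only [Equiv.Perm.one_apply]; split_ifs <;> omega
  | of_succ a hab ih =>
    rw [cyc_eq_swap_mul hab, Equiv.Perm.mul_apply, ih, Equiv.swap_apply_def]
    split_ifs <;> omega

theorem cyc_one_pow_apply {N j : ℕ} (hj : j ≤ N) (x : ℕ) :
    (cyc 1 N ^ j) x =
      if x = 0 ∨ N < x then x else if x + j ≤ N then x + j else x + j - N := by
  induction j with
  | zero => simp only [pow_zero, Equiv.Perm.one_apply]; split_ifs <;> omega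
  | succ j ih =>
    rw [pow_succ', Equiv.Perm.mul_apply, ih (by omega), cyc_apply (by omega)]
    split_ifs <;> omega

theorem blockT_apply (a b x : ℕ) :
    blockT a b x =
      if x = 0 ∨ a + b < x then x else if x ≤ a then x + b else x - a := by
  rw [blockT, cyc_one_pow_apply (by omega)]
  split_ifs <;> omega

theorem blockT_inv (a b : ℕ) : (blockT a b)⁻¹ = blockT b a := by
  rw [inv_eq_iff_mul_eq_one]
  ext x
  simp only [Equiv.Perm.mul_apply, Equiv.Perm.one_apply, blockT_apply]
  split_ifs <;> omega

theorem memS_one (n : ℕ) : memS n 1 := fun _ _ => rfl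

theorem memS_mul {n : ℕ} {σ τ : Equiv.Perm ℕ} (hσ : memS n σ) (hτ : memS n τ) :
    memS n (σ * τ) := fun j hj => by
  rw [Equiv.Perm.mul_apply, hτ j hj, hσ j hj]

theorem memS_blockT {a b N : ℕ} (h : a + b ≤ N) : memS N (blockT a b) := fun j hj => by
  rw [blockT_apply, if_pos (by omega)]

theorem sEmb_one_right (n m : ℕ) (σ : Equiv.Perm ℕ) : sEmb n m σ 1 = σ := by
  simp [sEmb]

/-- The block transposition of two blocks of sizes `a` and `b`, placed after a fixed
block of size `n`. -/
def shiftedBlockT (n a b : ℕ) : Equiv.Perm ℕ := sEmb n (a + b) 1 (blockT a b)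

theorem shiftedBlockT_apply (n a b x : ℕ) :
    shiftedBlockT n a b x =
      if x ≤ n ∨ n + a + b < x then x else if x ≤ n + a then x + b else x - a := by
  simp only [shiftedBlockT, sEmb, one_mul, blockT_inv, Equiv.Perm.mul_apply, blockT_apply]
  split_ifs <;> omega

theorem shiftedBlockT_inv (n a b : ℕ) :
    (shiftedBlockT n a b)⁻¹ = shiftedBlockT n b a := by
  rw [inv_eq_iff_mul_eq_one]
  ext x
  simp only [Equiv.Perm.mul_apply, Equiv.Perm.one_apply, shiftedBlockT_apply]
  split_ifs <;> omega

theorem memS_shiftedBlockT {n a b N : ℕ} (h : n + a + b ≤ N) :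
    memS N (shiftedBlockT n a b) := fun j hj => by
  rw [shiftedBlockT_apply, if_pos (by omega)]

theorem sEmb_one_blockT (n a b N : ℕ) (h : N = a + b) :
    sEmb n N 1 (blockT a b) = shiftedBlockT n a b := by
  rw [h, shiftedBlockT]

theorem blockT_mul_blockT_mul_shiftedBlockT (n m p : ℕ) :
    blockT p (n + m) * (blockT n p * shiftedBlockT n m p) = 1 := by
  ext x
  simp only [Equiv.Perm.mul_apply, Equiv.Perm.one_apply, shiftedBlockT_apply, blockT_apply]
  split_ifs <;> omega

theorem shiftedBlockT_mul_blockT_mul_blockT (n m p : ℕ) :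
    shiftedBlockT n p m * blockT p n * blockT (n + m) p = 1 := by
  rw [← inv_inj, mul_inv_rev, mul_inv_rev, blockT_inv, blockT_inv, shiftedBlockT_inv, inv_one,
    blockT_mul_blockT_mul_shiftedBlockT]

theorem blockT_mul_blockT (n m p : ℕ) :
    blockT p (n + m) * blockT n p = shiftedBlockT n p m := by
  rw [← shiftedBlockT_inv, eq_inv_iff_mul_eq_one, mul_assoc,
    blockT_mul_blockT_mul_shiftedBlockT]

theorem blockT_mul_blockT' (n m p : ℕ) :
    blockT p n * blockT (n + m) p = shiftedBlockT n m p := by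
  rw [← inv_inj, mul_inv_rev, blockT_inv, blockT_inv, shiftedBlockT_inv, blockT_mul_blockT]

theorem rP_shiftedBlockT {n m p i : ℕ} (hi : 1 ≤ i) (hip : i ≤ p + 1) :
    rP (n + p + m + 1) (n + m + i) (shiftedBlockT n m (p + 1)) = shiftedBlockT n m p := by
  have h : shiftedBlockT n m (p + 1) (n + m + i) = n + i := by
    rw [shiftedBlockT_apply]; split_ifs <;> omega
  rw [rP, h, mul_assoc, inv_mul_eq_iff_eq_mul]
  ext x
  simp only [Equiv.Perm.mul_apply, shiftedBlockT_apply,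
    cyc_apply (show n + i ≤ n + p + m + 1 by omega),
    cyc_apply (show n + m + i ≤ n + p + m + 1 by omega)]
  split_ifs <;> omega

theorem lP_shiftedBlockT {n m p j : ℕ} (hj : 1 ≤ j) (hjp : j ≤ p + 1) :
    lP (n + p + m + 1) (n + m + j) (shiftedBlockT n (p + 1) m) = shiftedBlockT n p m := by
  rw [lP, shiftedBlockT_inv, rP_shiftedBlockT hj hjp, shiftedBlockT_inv]

end Permutations

section Transport

variable {k : Type} [Field k] {S : ℕ → Type} [∀ n, AddCommGroup (S n)] [∀ n, Module k (S n)]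

theorem cast_add {a b : ℕ} (h : a = b) (x y : S a) :
    cast (congrArg S h) (x + y) = cast (congrArg S h) x + cast (congrArg S h) y := by
  subst h; rfl

theorem cast_neg {a b : ℕ} (h : a = b) (x : S a) :
    cast (congrArg S h) (-x) = -cast (congrArg S h) x := by
  subst h; rfl

theorem action_cast (L : ∀ n, Equiv.Perm ℕ → S n →ₗ[k] S n) {a b : ℕ} (h : a = b)
    (σ : Equiv.Perm ℕ) (x : S a) :
    L b σ (cast (congrArg S h) x) = cast (congrArg S h) (L a σ x) := by
  subst h; rfl

theorem contraction_cast (t : ∀ n : ℕ, ℕ → ℕ → (S (n + 1) →ₗ[k] S n)) {a b : ℕ} (h : a = b)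
    (h' : a + 1 = b + 1) (j i : ℕ) (x : S (a + 1)) :
    t b j i (cast (congrArg S h') x) = cast (congrArg S h) (t a j i x) := by
  subst h; rfl

theorem bilin_cast_left (mu : ∀ n m : ℕ, S n →ₗ[k] S m →ₗ[k] S (n + m)) {a b c : ℕ} (h : a = b)
    (x : S a) (y : S c) :
    mu b c (cast (congrArg S h) x) y =
      cast (congrArg S (congrArg (· + c) h)) (mu a c x y) := by
  subst h; rfl

theorem bilin_cast_right (mu : ∀ n m : ℕ, S n →ₗ[k] S m →ₗ[k] S (n + m)) {a b c : ℕ} (h : a = b)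
    (x : S c) (y : S a) :
    mu c b x (cast (congrArg S h) y) =
      cast (congrArg S (congrArg (c + ·) h)) (mu c a x y) := by
  subst h; rfl

end Transport

theorem IsDiagAction.comp {k : Type} [Field k] {S : ℕ → Type}
    [∀ n, AddCommGroup (S n)] [∀ n, Module k (S n)]
    {L R : ∀ n, Equiv.Perm ℕ → S n →ₗ[k] S n} (hact : IsDiagAction k S L R)
    {n : ℕ} {σ σ' τ τ' : Equiv.Perm ℕ} (hσ : memS n σ) (hσ' : memS n σ') (hτ : memS n τ)
    (hτ' : memS n τ') (x : S n) :
    L n σ (R n τ (L n σ' (R n τ' x))) = L n (σ * σ') (R n (τ' * τ) x) := by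
  rw [((hact n).2 σ σ' hσ hσ' _).1, ((hact n).2 τ' τ hτ' hτ _).2.1,
    ((hact n).2 σ' τ hσ' hτ _).2.2]

/-- The Leibniz identity in the first argument:
`{μ(v,w), u} = μ(v, {w,u}) + β · μ({v,u}, w) · β⁻¹`, with `β` exchanging the last two blocks. -/
theorem bracket_mul_left {k : Type} [Field k] {S : ℕ → Type}
    [∀ n, AddCommGroup (S n)] [∀ n, Module k (S n)]
    {L R : ∀ n, Equiv.Perm ℕ → S n →ₗ[k] S n}
    {mu br : ∀ n m : ℕ, S n →ₗ[k] S m →ₗ[k] S (n + m)}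
    (hact : IsDiagAction k S L R)
    (hmu : ∀ (n m : ℕ) (σ τ σ' τ' : Equiv.Perm ℕ),
      memS n σ → memS n τ → memS m σ' → memS m τ' →
      ∀ (v : S n) (w : S m),
        mu n m (L n σ (R n τ v)) (L m σ' (R m τ' w)) =
          L (n + m) (sEmb n m σ σ') (R (n + m) (sEmb n m τ τ') (mu n m v w)))
    (hskew : ∀ (n m : ℕ) (h : m + n = n + m) (v : S n) (w : S m),
      br n m v w =
        - cast (congrArg S h)
            (L (m + n) (blockT m n) (R (m + n) (blockT n m) (br m n w v))))
    (hleib : ∀ (p n m : ℕ) (h : p + n + m = p + (n + m)) (h' : n + (p + m) = p + (n + m))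
      (u : S p) (v : S n) (w : S m),
      br p (n + m) u (mu n m v w) =
        cast (congrArg S h)
            (mu (p + n) m (br p n u v) w) +
          cast (congrArg S h')
            (L (n + (p + m)) (blockT n p)
              (R (n + (p + m)) (blockT p n) (mu n (p + m) v (br p m u w)))))
    (n m p : ℕ) (v : S n) (w : S m) (u : S p) :
    br (n + m) p (mu n m v w) u =
      cast (congrArg S (by omega : n + (m + p) = n + m + p)) (mu n (m + p) v (br m p w u)) +
        cast (congrArg S (by omega : n + p + m = n + m + p))
          (L (n + p + m) (shiftedBlockT n p m)
            (R (n + p + m) (shiftedBlockT n m p) (mu (n + p) m (br n p v u) w))) := by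
  have hfirst : mu (p + n) m (br p n u v) w =
      -cast (congrArg S (by omega : n + p + m = p + n + m))
        (L (n + p + m) (blockT n p) (R (n + p + m) (blockT p n)
          (mu (n + p) m (br n p v u) w))) := by
    have h := hmu (n + p) m (blockT n p) (blockT p n) 1 1 (memS_blockT le_rfl)
      (memS_blockT (by omega)) (memS_one m) (memS_one m) (br n p v u) w
    rw [((hact m).1 _).1, ((hact m).1 _).2, sEmb_one_right, sEmb_one_right] at h
    rw [hskew p n (by omega) u v, map_neg, LinearMap.neg_apply,
      bilin_cast_left mu (by omega : n + p = p + n), h]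
  have hsecond : mu n (p + m) v (br p m u w) =
      -cast (congrArg S (by omega : n + (m + p) = n + (p + m)))
        (L (n + (m + p)) (shiftedBlockT n m p) (R (n + (m + p)) (shiftedBlockT n p m)
          (mu n (m + p) v (br m p w u)))) := by
    have h := hmu n (m + p) 1 1 (blockT m p) (blockT p m) (memS_one n) (memS_one n)
      (memS_blockT le_rfl) (memS_blockT (by omega)) v (br m p w u)
    rw [((hact n).1 _).1, ((hact n).1 _).2, sEmb_one_blockT n m p _ rfl,
      sEmb_one_blockT n p m _ (by omega)] at h
    rw [hskew p m (by omega) u w, map_neg, bilin_cast_right mu (by omega : m + p = p + m), h]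
  rw [hskew (n + m) p (by omega), hleib p n m (by omega) (by omega), hfirst, hsecond]
  have hcast₁ : p + n + m = p + (n + m) := by omega
  have hcast₂ : n + p + m = p + (n + m) := by omega
  have hcast₃ : n + (p + m) = p + (n + m) := by omega
  have hcast₄ : n + (m + p) = n + (p + m) := by omega
  have hcast₅ : n + (m + p) = p + (n + m) := by omega
  have hcast₆ : p + (n + m) = n + m + p := by omega
  simp only [map_neg, map_add, cast_neg hcast₁, cast_neg hcast₃, cast_neg hcast₆,
    cast_add hcast₆, action_cast R hcast₂, action_cast L hcast₂, action_cast R hcast₄,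
    action_cast L hcast₄, action_cast R hcast₅, action_cast L hcast₅, cast_cast, neg_add,
    neg_neg]
  rw [hact.comp (memS_blockT (by omega)) (memS_blockT (by omega)) (memS_blockT (by omega))
      (memS_blockT (by omega)),
    hact.comp (memS_blockT (by omega)) (memS_shiftedBlockT (by omega)) (memS_blockT (by omega))
      (memS_shiftedBlockT (by omega)),
    hact.comp (memS_blockT (by omega))
      (memS_mul (memS_blockT (by omega)) (memS_shiftedBlockT (by omega)))
      (memS_blockT (by omega))
      (memS_mul (memS_shiftedBlockT (by omega)) (memS_blockT (by omega))),
    blockT_mul_blockT, blockT_mul_blockT', blockT_mul_blockT_mul_shiftedBlockT,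
    shiftedBlockT_mul_blockT_mul_blockT, ((hact _).1 _).1, ((hact _).1 _).2]
  exact add_comm _ _

/-- Let `S` be a commutative wheelgebra and `{ , }_{n,m} = br n m` a
`k`-bilinear family which is equivariant, skew-symmetric and satisfies the
Leibniz identity.  If `v ∈ S n` and `w ∈ S m` are wheel-compatible, then so is
`μ_{n,m}(v, w) ∈ S (n+m)`. -/
theorem wheelCompatible_mul (k : Type) [Field k] (S : ℕ → Type)
    [∀ n, AddCommGroup (S n)] [∀ n, Module k (S n)]
    (L R : ∀ n, Equiv.Perm ℕ → S n →ₗ[k] S n)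
    (t : ∀ n : ℕ, ℕ → ℕ → (S (n + 1) →ₗ[k] S n))
    (mu : ∀ n m : ℕ, S n →ₗ[k] S m →ₗ[k] S (n + m)) (eta : S 0)
    (hcomm : IsCommWheelgebra k S L R t mu eta)
    (br : ∀ n m : ℕ, S n →ₗ[k] S m →ₗ[k] S (n + m))
    -- equivariance of the bracket
    (hequiv : ∀ (n m : ℕ) (σ τ σ' τ' : Equiv.Perm ℕ),
      memS n σ → memS n τ → memS m σ' → memS m τ' →
      ∀ (v : S n) (w : S m),
        br n m (L n σ (R n τ v)) (L m σ' (R m τ' w)) =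
          L (n + m) (sEmb n m σ σ') (R (n + m) (sEmb n m τ τ') (br n m v w)))
    -- skew-symmetry: `{v,w}_{n,m} = - b_{m,n}(1 2)·{w,v}_{m,n}·b_{n,m}(1 2)`
    (hskew : ∀ (n m : ℕ) (v : S n) (w : S m),
      br n m v w =
        - cast (congrArg S (by omega : m + n = n + m))
            (L (m + n) (blockT m n) (R (m + n) (blockT n m) (br m n w v))))
    -- Leibniz identity: `{u, μ_{n,m}(v,w)}_{p,n+m}
    --   = μ_{p+n,m}({u,v}_{p,n}, w)
    --     + b_{n,p,m}(1 2)·μ_{n,p+m}(v, {u,w}_{p,m})·b_{p,n,m}(1 2)`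
    (hleib : ∀ (p n m : ℕ) (u : S p) (v : S n) (w : S m),
      br p (n + m) u (mu n m v w) =
        cast (congrArg S (by omega : p + n + m = p + (n + m)))
            (mu (p + n) m (br p n u v) w) +
          cast (congrArg S (by omega : n + (p + m) = p + (n + m)))
            (L (n + (p + m)) (blockT n p)
              (R (n + (p + m)) (blockT p n) (mu n (p + m) v (br p m u w))))) :
    ∀ (n m : ℕ) (v : S n) (w : S m),
      WheelCompatible k S t br n v → WheelCompatible k S t br m w →
      WheelCompatible k S t br (n + m) (mu n m v w) := by
  obtain ⟨⟨hact, ⟨hW, -⟩, -, -, hmu, htl, htr⟩, -⟩ := hcomm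
  intro n m v w hv hw p i j hi hip hj hjp u
  have hvu := hv p i j hi hip hj hjp u
  have hwu := hw p i j hi hip hj hjp u
  have hcast₁ : n + m + (p + 1) = n + m + p + 1 := by omega
  have hcast₂ : n + (m + p) = n + m + p := by omega
  have hcast₃ : n + p + m = n + m + p := by omega
  have hcast₄ : m + (p + 1) = m + p + 1 := by omega
  have hcast₅ : n + (p + 1) = n + p + 1 := by omega
  have hcast₆ : n + (p + 1) + m = n + p + m + 1 := by omega
  have hbr := bracket_mul_left hact hmu (fun n m _ => hskew n m) (fun p n m _ _ => hleib p n m)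
  rw [hbr, hbr, cast_add hcast₁, map_add]
  congr 1
  · have h := htr n (m + p) (n + (m + i)) (n + (m + j)) (by omega) (by omega) (by omega)
      (by omega) v (cast (congrArg S hcast₄) (br m (p + 1) w u))
    rw [Nat.add_sub_cancel_left, Nat.add_sub_cancel_left, hwu, bilin_cast_right mu hcast₄,
      cast_cast] at h
    rw [← h, ← contraction_cast t hcast₂ (by omega), cast_cast, cast_cast, add_assoc n m j,
      add_assoc n m i]
  · have h := htl (n + p) m (n + i) (n + j) (by omega) (by omega) (by omega) (by omega)
      (cast (congrArg S hcast₅) (br n (p + 1) v u)) w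
    rw [hvu, bilin_cast_left mu hcast₅, cast_cast] at h
    have hσ : (shiftedBlockT n (p + 1) m)⁻¹ (n + m + j) = n + j := by
      rw [shiftedBlockT_inv, shiftedBlockT_apply]; split_ifs <;> omega
    have hτ : shiftedBlockT n m (p + 1) (n + m + i) = n + i := by
      rw [shiftedBlockT_apply]; split_ifs <;> omega
    have hcontr := hW (n + p + m) (n + m + i) (n + m + j) (by omega) (by omega) (by omega)
      (by omega) (shiftedBlockT n (p + 1) m) (shiftedBlockT n m (p + 1))
      (memS_shiftedBlockT (by omega)) (memS_shiftedBlockT (by omega))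
      (cast (congrArg S hcast₆) (mu (n + (p + 1)) m (br n (p + 1) v u) w))
    rw [hσ, hτ, rP_shiftedBlockT hi hip, lP_shiftedBlockT hj hjp, h,
      action_cast R hcast₆, action_cast L hcast₆] at hcontr
    rw [← hcontr, ← contraction_cast t hcast₃ (by omega), cast_cast, cast_cast]
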